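/- arXiv:2410.22438 — 5 statements merged into one kernel-verified Lean document; each statement's English description precedes it below -/
import Mathlib

section
/- Let Ω ⊂ ℝ² be a bounded open set with smooth boundary, b ∈ (0,1), ε > 0, and a : Ω → ℝ measurable with b ≤ a ≤ 1 on Ω. Suppose ρ ∈ C¹(clos(Ω); ℝ) with ρ > 0 satisfies the weak Neumann Euler–Lagrange identity ∫_Ω ∇ρ·∇φ = ε⁻² ∫_Ω ρ(a − ρ²)φ for every Lipschitz function φ : clos(Ω) → ℝ. Then for every u ∈ C¹(clos(Ω); ℂ) and A ∈ C¹(clos(Ω); ℝ²) one has the decoupling identity: ½∫_Ω ( |∇_A(ρu)|² + (a − ρ²|u|²)²/(2ε²) ) = E_ε(ρ) + ½∫_Ω ( ρ²|∇_A u|² + ρ⁴(1 − |u|²)²/(2ε²) ). -/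
noncomputable section

open MeasureTheory

/-- The plane ℝ², with its Euclidean structure. -/
abbrev V2 : Type := EuclideanSpace ℝ (Fin 2)

/-- The first standard basis vector of the plane. -/
def ee1 : V2 := EuclideanSpace.single (0 : Fin 2) (1 : ℝ)

/-- The second standard basis vector of the plane. -/
def ee2 : V2 := EuclideanSpace.single (1 : Fin 2) (1 : ℝ)

/-- First partial derivative. -/
def pd1 {E : Type*} [NormedAddCommGroup E] [NormedSpace ℝ E] (f : V2 → E) (x : V2) : E :=
  fderiv ℝ f x ee1

/-- Second partial derivative. -/
def pd2 {E : Type*} [NormedAddCommGroup E] [NormedSpace ℝ E] (f : V2 → E) (x : V2) : E :=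
  fderiv ℝ f x ee2

/-- The vector of ℝ² with the given coordinates. -/
def mkV (a b : ℝ) : V2 := (EuclideanSpace.equiv (Fin 2) ℝ).symm ![a, b]

/-- Squared norm of the gradient of a real-valued function. -/
def gradSq (v : V2 → ℝ) (x : V2) : ℝ := (pd1 v x) ^ 2 + (pd2 v x) ^ 2

/-- First component of the covariant gradient ∇_A u = ∇u - iAu. -/
def covD1 (u : V2 → ℂ) (A : V2 → V2) (y : V2) : ℂ := pd1 u y - Complex.I * (A y 0 : ℂ) * u y

/-- Second component of the covariant gradient ∇_A u = ∇u - iAu. -/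
def covD2 (u : V2 → ℂ) (A : V2 → V2) (y : V2) : ℂ := pd2 u y - Complex.I * (A y 1 : ℂ) * u y

/-- Squared norm of the covariant gradient. -/
def covGradSq (u : V2 → ℂ) (A : V2 → V2) (x : V2) : ℝ :=
  ‖covD1 u A x‖ ^ 2 + ‖covD2 u A x‖ ^ 2

/-- Curl of a planar vector field. -/
def curl2 (A : V2 → V2) (x : V2) : ℝ :=
  pd1 (fun y => A y 1) x - pd2 (fun y => A y 0) x

/-- Divergence of a planar vector field. -/
def div2 (A : V2 → V2) (x : V2) : ℝ :=
  pd1 (fun y => A y 0) x + pd2 (fun y => A y 1) x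

/-- The real scalar product ⟨z,w⟩ = Re (z · conj w) on ℂ. -/
def rin (z w : ℂ) : ℝ := (z * (starRingEnd ℂ) w).re

/-- Superconducting current ⟨iu, ∇_A u⟩. -/
def scurrent (u : V2 → ℂ) (A : V2 → V2) (x : V2) : V2 :=
  mkV (rin (Complex.I * u x) (covD1 u A x)) (rin (Complex.I * u x) (covD2 u A x))

/-- Vorticity μ(u,A) = curl(⟨iu,∇_A u⟩ + A). -/
def vorticity (u : V2 → ℂ) (A : V2 → V2) (x : V2) : ℝ :=
  curl2 (fun y => scurrent u A y + A y) x

/-- Pinned Ginzburg–Landau energy without magnetic field (real-valued configuration). -/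
def Eeps (Ω : Set V2) (a : V2 → ℝ) (ε : ℝ) (v : V2 → ℝ) : ℝ :=
  (1 / 2) * ∫ x in Ω, (gradSq v x + (a x - v x ^ 2) ^ 2 / (2 * ε ^ 2))

/-- Weighted Ginzburg–Landau free energy F_{ε,ρ}(u,A). -/
def Feps (Ω : Set V2) (ε : ℝ) (ρ : V2 → ℝ) (u : V2 → ℂ) (A : V2 → V2) : ℝ :=
  (1 / 2) * ∫ x in Ω, (ρ x ^ 2 * covGradSq u A x
    + ρ x ^ 4 * (1 - ‖u x‖ ^ 2) ^ 2 / (2 * ε ^ 2) + curl2 A x ^ 2)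

/-- Full Ginzburg–Landau energy with pinning and applied field. -/
def GLeps (Ω : Set V2) (a : V2 → ℝ) (ε hex : ℝ) (u : V2 → ℂ) (A : V2 → V2) : ℝ :=
  (1 / 2) * ∫ x in Ω, (covGradSq u A x + (a x - ‖u x‖ ^ 2) ^ 2 / (2 * ε ^ 2)
    + (curl2 A x - hex) ^ 2)

/-- Weak (Neumann) Euler–Lagrange identity for ρ, tested against Lipschitz functions. -/
def WeakEL (Ω : Set V2) (a : V2 → ℝ) (ε : ℝ) (ρ : V2 → ℝ) : Prop :=
  ∀ φ : V2 → ℝ, (∃ K : NNReal, LipschitzWith K φ) →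
    ∫ x in Ω, (pd1 ρ x * pd1 φ x + pd2 ρ x * pd2 φ x)
      = (ε ^ 2)⁻¹ * ∫ x in Ω, ρ x * (a x - ρ x ^ 2) * φ x

/-- Data witnessing that the open set Ω has smooth boundary:
a global smooth defining function with nonvanishing gradient on the boundary. -/
structure SmoothBdry (Ω : Set V2) where
  f : V2 → ℝ
  smooth : ContDiff ℝ (⊤ : ℕ∞) f
  eq_set : Ω = {x | f x < 0}
  grad_ne : ∀ x ∈ frontier Ω, fderiv ℝ f x ≠ 0

/-- The outward unit normal to ∂Ω computed from a smooth defining function. -/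
def SmoothBdry.normal {Ω : Set V2} (sb : SmoothBdry Ω) (x : V2) : V2 :=
  ‖mkV (pd1 sb.f x) (pd2 sb.f x)‖⁻¹ • mkV (pd1 sb.f x) (pd2 sb.f x)

/-- The first Ginzburg–Landau equation -(div - iA·)(∇_A u) = u(a-|u|²)/ε² in Ω. -/
def GLeq1 (Ω : Set V2) (a : V2 → ℝ) (ε : ℝ) (u : V2 → ℂ) (A : V2 → V2) : Prop :=
  ∀ x ∈ Ω,
    -(pd1 (covD1 u A) x + pd2 (covD2 u A) x
        - Complex.I * ((A x 0 : ℂ) * covD1 u A x + (A x 1 : ℂ) * covD2 u A x))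
      = u x * ((a x - ‖u x‖ ^ 2 : ℝ) : ℂ) / (ε : ℂ) ^ 2

/-- The covariant Neumann boundary condition (∇_A u)·ν = 0 on ∂Ω. -/
def CovNeumann (Ω : Set V2) (sb : SmoothBdry Ω) (u : V2 → ℂ) (A : V2 → V2) : Prop :=
  ∀ x ∈ frontier Ω,
    covD1 u A x * (sb.normal x 0 : ℂ) + covD2 u A x * (sb.normal x 1 : ℂ) = 0

/-- The second Ginzburg–Landau equation -∇⊥(curl A) = ⟨iu, ∇_A u⟩ in Ω. -/
def GLeq2 (Ω : Set V2) (u : V2 → ℂ) (A : V2 → V2) : Prop :=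
  ∀ x ∈ Ω,
    pd2 (curl2 A) x = rin (Complex.I * u x) (covD1 u A x) ∧
    -(pd1 (curl2 A) x) = rin (Complex.I * u x) (covD2 u A x)

/-- Coulomb gauge: div A = 0 in Ω and A·ν = 0 on ∂Ω. -/
def CoulombGauge (Ω : Set V2) (sb : SmoothBdry Ω) (A : V2 → V2) : Prop :=
  (∀ x ∈ Ω, div2 A x = 0) ∧
  (∀ x ∈ frontier Ω, A x 0 * sb.normal x 0 + A x 1 * sb.normal x 1 = 0)

/-- The classical PDE -div(∇ξ/ρ²) + ξ = 1 at points of Ω. -/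
def XiPDE (Ω : Set V2) (ρ ξ : V2 → ℝ) : Prop :=
  ∀ x ∈ Ω,
    -(pd1 (fun y => pd1 ξ y / ρ y ^ 2) x + pd2 (fun y => pd2 ξ y / ρ y ^ 2) x) + ξ x = 1

/-- The Meissner approximation vector potential A⁰ = -∇⊥ξ/ρ². -/
def meissnerA0 (ρ ξ : V2 → ℝ) : V2 → V2 :=
  fun y => mkV (pd2 ξ y / ρ y ^ 2) (-(pd1 ξ y) / ρ y ^ 2)

/-- The product rule for `‖∂_v (ρ u) - i α ρ u‖²`, with the cross terms collected into the derivative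
of `ρ (‖u‖² - 1)`. -/
lemma norm_sq_covariant_fderiv_mul {ρ : V2 → ℝ} {u : V2 → ℂ} {x : V2}
    (hρ : DifferentiableAt ℝ ρ x) (hu : DifferentiableAt ℝ u x) (v : V2) (α : ℝ) :
    ‖fderiv ℝ (fun y => (ρ y : ℂ) * u y) x v - Complex.I * (α : ℂ) * ((ρ x : ℂ) * u x)‖ ^ 2
      = (fderiv ℝ ρ x v) ^ 2
        + ρ x ^ 2 * ‖fderiv ℝ u x v - Complex.I * (α : ℂ) * u x‖ ^ 2
        + fderiv ℝ ρ x v * fderiv ℝ (fun y => ρ y * (‖u y‖ ^ 2 - 1)) x v := by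
  have h1 : fderiv ℝ (fun y => (ρ y : ℂ) * u y) x v
      = (fderiv ℝ ρ x v : ℂ) * u x + (ρ x : ℂ) * fderiv ℝ u x v := by
    have h := (hρ.hasFDerivAt.smul hu.hasFDerivAt).fderiv
    have e : (fun y => (ρ y : ℂ) * u y) = ρ • u := by
      funext y; simp
    rw [e, h]
    simp [add_comm]
  have h2 : fderiv ℝ (fun y => ρ y * (‖u y‖ ^ 2 - 1)) x v
      = fderiv ℝ ρ x v * (‖u x‖ ^ 2 - 1)
        + ρ x * (2 * ((u x).re * (fderiv ℝ u x v).re + (u x).im * (fderiv ℝ u x v).im)) := by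
    have h := (hρ.hasFDerivAt.mul (hu.hasFDerivAt.norm_sq.sub_const 1)).fderiv
    change fderiv ℝ (ρ * fun y => ‖u y‖ ^ 2 - 1) x v = _
    rw [h]
    simp [Complex.inner]
    ring
  rw [h1, h2]
  simp only [Complex.sq_norm, Complex.normSq_apply]
  simp
  ring

/-- A continuously differentiable function agrees on any bounded set, to first order, with a
Lipschitz function. -/
lemma exists_lipschitzWith_eventuallyEq {φ : V2 → ℝ} (hφ : ContDiff ℝ 1 φ) {s : Set V2}
    (hs : Bornology.IsBounded s) :
    ∃ ψ : V2 → ℝ, (∃ K : NNReal, LipschitzWith K ψ) ∧ ∀ x ∈ s, ψ =ᶠ[nhds x] φ := by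
  obtain ⟨R, hR, hsR⟩ := hs.subset_ball_lt 0 (0 : V2)
  let χ : ContDiffBump (0 : V2) := ⟨R, R + 1, hR, by linarith⟩
  refine ⟨fun y => χ y * φ y, ?_, fun x hx => ?_⟩
  · exact (χ.contDiff.mul hφ).lipschitzWith_of_hasCompactSupport
      (χ.hasCompactSupport.mul_right) one_ne_zero
  · filter_upwards [χ.eventuallyEq_one_of_mem_ball (hsR hx)] with y hy
    simp [hy]

lemma Continuous.integrableOn_of_isBounded {f : V2 → ℝ} (hf : Continuous f) {s : Set V2}
    (hs : Bornology.IsBounded s) : IntegrableOn f s :=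
  (hf.continuousOn.integrableOn_compact hs.isCompact_closure).mono_set subset_closure

/-- Lassoued–Mironescu decoupling of the pinned energy with magnetic field. -/
theorem statement0
    (Ω : Set V2) (hΩo : IsOpen Ω) (hΩb : Bornology.IsBounded Ω)
    (hsb : Nonempty (SmoothBdry Ω))
    (b : ℝ) (hb : b ∈ Set.Ioo (0 : ℝ) 1)
    (ε : ℝ) (hε : 0 < ε)
    (a : V2 → ℝ) (ham : Measurable a) (hab : ∀ x ∈ Ω, b ≤ a x ∧ a x ≤ 1)
    (ρ : V2 → ℝ) (hρ : ContDiff ℝ 1 ρ) (hρpos : ∀ x ∈ closure Ω, 0 < ρ x)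
    (hEL : WeakEL Ω a ε ρ) :
    ∀ (u : V2 → ℂ) (A : V2 → V2), ContDiff ℝ 1 u → ContDiff ℝ 1 A →
      (1 / 2) * ∫ x in Ω, (covGradSq (fun y => (ρ y : ℂ) * u y) A x
          + (a x - ρ x ^ 2 * ‖u x‖ ^ 2) ^ 2 / (2 * ε ^ 2))
        = Eeps Ω a ε ρ
          + (1 / 2) * ∫ x in Ω, (ρ x ^ 2 * covGradSq u A x
              + ρ x ^ 4 * (1 - ‖u x‖ ^ 2) ^ 2 / (2 * ε ^ 2)) := by
  intro u A hu hA
  have hρc := hρ.continuous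
  have huc := hu.continuous
  have hAc := hA.continuous
  have hdρ : Continuous (fderiv ℝ ρ) := hρ.continuous_fderiv one_ne_zero
  have hdu : Continuous (fderiv ℝ u) := hu.continuous_fderiv one_ne_zero
  have hφ : ContDiff ℝ 1 (fun y => ρ y * (‖u y‖ ^ 2 - 1)) :=
    hρ.mul ((hu.norm_sq ℝ).sub contDiff_const)
  have hdφ := hφ.continuous_fderiv one_ne_zero
  obtain ⟨ψ, hψ, hψφ⟩ := exists_lipschitzWith_eventuallyEq hφ hΩb
  have hmul : ∀ h : V2 → ℝ, IntegrableOn h Ω → IntegrableOn (fun x => a x * h x) Ω := by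
    intro h hh
    refine hh.bdd_mul (c := 1) ham.aestronglyMeasurable ?_
    filter_upwards [ae_restrict_mem hΩo.measurableSet] with x hx
    rw [Real.norm_eq_abs, abs_le]
    constructor <;> linarith [hab x hx, hb.1]
  have haρ : ∀ h : V2 → ℝ, Continuous h → IntegrableOn (fun x => a x * h x) Ω :=
    fun h hh => hmul h (hh.integrableOn_of_isBounded hΩb)
  have hE : IntegrableOn (fun x => gradSq ρ x + (a x - ρ x ^ 2) ^ 2 / (2 * ε ^ 2)) Ω := by
    have h0 : IntegrableOn (fun x => gradSq ρ x + (ρ x ^ 2) ^ 2 / (2 * ε ^ 2)) Ω := by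
      refine Continuous.integrableOn_of_isBounded ?_ hΩb
      unfold gradSq pd1 pd2
      fun_prop
    have h1 := hmul _ (haρ (fun _ => 1 / (2 * ε ^ 2)) continuous_const)
    have h2 := haρ (fun x => 2 * ρ x ^ 2 / (2 * ε ^ 2)) (by fun_prop)
    refine ((h0.add h1).sub h2).congr (Filter.Eventually.of_forall fun x => ?_)
    simp only [Pi.add_apply, Pi.sub_apply]
    ring
  have hF : IntegrableOn (fun x => ρ x ^ 2 * covGradSq u A x
      + ρ x ^ 4 * (1 - ‖u x‖ ^ 2) ^ 2 / (2 * ε ^ 2)) Ω := by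
    refine Continuous.integrableOn_of_isBounded ?_ hΩb
    unfold covGradSq covD1 covD2 pd1 pd2
    fun_prop
  have hD : IntegrableOn (fun x => pd1 ρ x * pd1 (fun y => ρ y * (‖u y‖ ^ 2 - 1)) x
      + pd2 ρ x * pd2 (fun y => ρ y * (‖u y‖ ^ 2 - 1)) x) Ω := by
    refine Continuous.integrableOn_of_isBounded ?_ hΩb
    unfold pd1 pd2
    fun_prop
  have hK : IntegrableOn (fun x => ρ x * (a x - ρ x ^ 2) * (ρ x * (‖u x‖ ^ 2 - 1))) Ω := by
    have h0 : IntegrableOn (fun x => ρ x ^ 3 * (ρ x * (‖u x‖ ^ 2 - 1))) Ω :=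
      Continuous.integrableOn_of_isBounded (by fun_prop) hΩb
    have h1 := haρ (fun x => ρ x * (ρ x * (‖u x‖ ^ 2 - 1))) (by fun_prop)
    refine (h1.sub h0).congr (Filter.Eventually.of_forall fun x => ?_)
    simp only [Pi.sub_apply]
    ring
  have hEL' : ∫ x in Ω, (pd1 ρ x * pd1 (fun y => ρ y * (‖u y‖ ^ 2 - 1)) x
        + pd2 ρ x * pd2 (fun y => ρ y * (‖u y‖ ^ 2 - 1)) x)
      = ∫ x in Ω, (ε ^ 2)⁻¹ * (ρ x * (a x - ρ x ^ 2) * (ρ x * (‖u x‖ ^ 2 - 1))) := by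
    rw [integral_const_mul]
    convert hEL ψ hψ using 1
    · refine setIntegral_congr_fun hΩo.measurableSet fun x hx => ?_
      simp only [pd1, pd2, (hψφ x hx).fderiv_eq]
    · congr 1
      refine setIntegral_congr_fun hΩo.measurableSet fun x hx => ?_
      simp only [(hψφ x hx).eq_of_nhds]
  have hkey : ∀ x, covGradSq (fun y => (ρ y : ℂ) * u y) A x
        + (a x - ρ x ^ 2 * ‖u x‖ ^ 2) ^ 2 / (2 * ε ^ 2)
      = ((gradSq ρ x + (a x - ρ x ^ 2) ^ 2 / (2 * ε ^ 2))
        + (ρ x ^ 2 * covGradSq u A x + ρ x ^ 4 * (1 - ‖u x‖ ^ 2) ^ 2 / (2 * ε ^ 2)))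
        + ((pd1 ρ x * pd1 (fun y => ρ y * (‖u y‖ ^ 2 - 1)) x
          + pd2 ρ x * pd2 (fun y => ρ y * (‖u y‖ ^ 2 - 1)) x)
        - (ε ^ 2)⁻¹ * (ρ x * (a x - ρ x ^ 2) * (ρ x * (‖u x‖ ^ 2 - 1)))) := by
    intro x
    have hρx := hρ.differentiable one_ne_zero x
    have hux := hu.differentiable one_ne_zero x
    simp only [covGradSq, covD1, covD2, gradSq, pd1, pd2]
    rw [norm_sq_covariant_fderiv_mul hρx hux ee1, norm_sq_covariant_fderiv_mul hρx hux ee2]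
    field_simp
    ring
  simp only [hkey, Eeps]
  have hK' := hK.const_mul (ε ^ 2)⁻¹
  refine (congrArg (1 / 2 * ·) ((integral_add (hE.add hF) (hD.sub hK')).trans
    (congrArg₂ (· + ·) (integral_add hE hF) (integral_sub hD hK')))).trans ?_
  simp only [hEL', sub_self, add_zero, mul_add]
end
end

section
/- Let Ω ⊂ ℝ² be a bounded open set with smooth boundary and b ∈ (0,1). There exists a constant C > 0, depending only on Ω, such that for every ε ∈ (0,1], every continuous a : clos(Ω) → ℝ with b ≤ a ≤ 1, and every ρ ∈ C²(clos(Ω); ℝ) with 0 ≤ ρ ≤ 1 satisfying −Δρ = ρ(a − ρ²)/ε² in Ω and ∂ρ/∂ν = 0 on ∂Ω (ν the outward unit normal), one has sup_{x ∈ clos(Ω)} |∇ρ(x)| ≤ C/ε. -/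
noncomputable section

open MeasureTheory

open Filter Topology Metric

theorem eventually_gt_right_of_hasDerivAt_pos {g : ℝ → ℝ} {g' : ℝ} (hg : HasDerivAt g g' 0)
    (hpos : 0 < g') : ∀ᶠ t in 𝓝[>] (0 : ℝ), g 0 < g t := by
  have h := hg.tendsto_slope_zero_right
  filter_upwards [h.eventually (lt_mem_nhds hpos), self_mem_nhdsWithin] with t ht ht0
  have ht0' : (0 : ℝ) < t := ht0
  simp only [zero_add, smul_eq_mul] at ht
  have := (mul_pos_iff_of_pos_left (inv_pos.2 ht0')).1 ht
  linarith

theorem IsLocalMax.second_hasDerivAt_nonpos {g g' : ℝ → ℝ} {g'' : ℝ} (hmax : IsLocalMax g 0)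
    (hg : ∀ᶠ t in 𝓝 (0 : ℝ), HasDerivAt g (g' t) t) (hg' : HasDerivAt g' g'' 0) : g'' ≤ 0 := by
  by_contra! hpos
  have hderiv : deriv g =ᶠ[𝓝 0] g' := hg.mono fun t ht => ht.deriv
  have h2 : deriv (deriv g) 0 = g'' := hderiv.deriv_eq.trans hg'.deriv
  have hmin : IsLocalMin g 0 := isLocalMin_of_deriv_deriv_pos (by rw [h2]; exact hpos)
    hmax.deriv_eq_zero hg.self_of_nhds.continuousAt
  have hconst : g =ᶠ[𝓝 0] fun _ => g 0 := by
    filter_upwards [hmax, hmin] with t h1 h3 using le_antisymm h1 h3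
  have hzero : deriv (deriv g) 0 = 0 := by
    rw [(hconst.deriv).deriv_eq]
    simp
  linarith

section Line

variable {E : Type*} [NormedAddCommGroup E] [NormedSpace ℝ E]

theorem hasDerivAt_line (x a : E) (t : ℝ) : HasDerivAt (fun t : ℝ => x + t • a) a t := by
  simpa using ((hasDerivAt_id t).smul_const a).const_add x

theorem ContDiff.hasDerivAt_comp_line {u : E → ℝ} (hu : ContDiff ℝ 2 u) (x a : E) (t : ℝ) :
    HasDerivAt (fun t : ℝ => u (x + t • a)) (fderiv ℝ u (x + t • a) a) t :=
  ((hu.differentiable (by norm_num)) _).hasFDerivAt.comp_hasDerivAt t (hasDerivAt_line x a t)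

theorem ContDiff.hasDerivAt_fderiv_comp_line {u : E → ℝ} (hu : ContDiff ℝ 2 u) (x a : E)
    (t : ℝ) : HasDerivAt (fun t : ℝ => fderiv ℝ u (x + t • a) a)
      (fderiv ℝ (fderiv ℝ u) (x + t • a) a a) t := by
  have h1 : Differentiable ℝ (fderiv ℝ u) :=
    (hu.fderiv_right (m := 1) (by norm_num)).differentiable (by norm_num)
  have h2 := (h1 (x + t • a)).hasFDerivAt.comp_hasDerivAt t (hasDerivAt_line x a t)
  exact h2.clm_apply (hasDerivAt_const t a) |>.congr_deriv (by simp)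

end Line

/-- The concave modulus `r ↦ K (r - A r²)`. -/
def modulus (K A r : ℝ) : ℝ := K * (r - A * r ^ 2)

theorem hasDerivAt_modulus (K A r : ℝ) :
    HasDerivAt (modulus K A) (K * (1 - 2 * A * r)) r := by
  have := (((hasDerivAt_id r).sub (((hasDerivAt_id r).pow 2).const_mul A)).const_mul K)
  refine this.congr_deriv ?_
  push_cast
  simp only [id]
  ring

theorem hasDerivAt_modulus_line (K A r s t : ℝ) :
    HasDerivAt (fun t => modulus K A (r + s * t)) (s * (K * (1 - 2 * A * (r + s * t)))) t := by
  have h := (hasDerivAt_modulus K A (r + s * t)).comp t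
    (((hasDerivAt_id t).const_mul s).const_add r)
  refine h.congr_deriv ?_
  ring

theorem hasDerivAt_modulus_deriv_line (K A r s t : ℝ) :
    HasDerivAt (fun t => s * (K * (1 - 2 * A * (r + s * t)))) (-2 * A * K * s ^ 2) t := by
  have h := ((((((hasDerivAt_id t).const_mul s).const_add r).const_mul (2 * A)).const_sub
    1).const_mul K).const_mul s
  refine h.congr_deriv ?_
  ring

/-- The doubling-of-variables functional. -/
def doubling (u G : V2 → ℝ) (K A : ℝ) (p : V2 × V2) : ℝ :=
  u p.1 - u p.2 - modulus K A ‖p.1 - p.2‖ * (G p.1 * G p.2)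

theorem doubling_second_order {u G : V2 → ℝ} (hu : ContDiff ℝ 2 u) (hG : ContDiff ℝ 2 G)
    {K A : ℝ} {x y : V2} (hmax : IsLocalMax (doubling u G K A) (x, y)) {a b : V2} {s : ℝ}
    (hdist : ∀ᶠ t in 𝓝 (0 : ℝ), ‖(x + t • a) - (y + t • b)‖ = ‖x - y‖ + s * t) :
    fderiv ℝ (fderiv ℝ u) x a a - fderiv ℝ (fderiv ℝ u) y b b ≤
      -2 * A * K * s ^ 2 * (G x * G y)
        + 2 * (s * (K * (1 - 2 * A * ‖x - y‖)))
          * (fderiv ℝ G x a * G y + G x * fderiv ℝ G y b)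
        + modulus K A ‖x - y‖ * (fderiv ℝ (fderiv ℝ G) x a a * G y
          + 2 * (fderiv ℝ G x a * fderiv ℝ G y b) + G x * fderiv ℝ (fderiv ℝ G) y b b) := by
  set r := ‖x - y‖ with hr
  let q : ℝ → ℝ := fun t => u (x + t • a) - u (y + t • b)
    - modulus K A (r + s * t) * (G (x + t • a) * G (y + t • b))
  have hqmax : IsLocalMax q 0 := by
    have hcont : Tendsto (fun t : ℝ => (x + t • a, y + t • b)) (𝓝 0) (𝓝 (x, y)) := by
      have : Continuous (fun t : ℝ => (x + t • a, y + t • b)) := by fun_prop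
      simpa using this.tendsto 0
    filter_upwards [hcont.eventually hmax, hdist] with t ht htd
    simp only [doubling, htd] at ht
    simpa [q, hr] using ht
  have h1 := fun t => ((hu.hasDerivAt_comp_line x a t).sub (hu.hasDerivAt_comp_line y b t)).sub
    ((hasDerivAt_modulus_line K A r s t).mul
      ((hG.hasDerivAt_comp_line x a t).mul (hG.hasDerivAt_comp_line y b t)))
  have h2 := ((hu.hasDerivAt_fderiv_comp_line x a 0).sub
      (hu.hasDerivAt_fderiv_comp_line y b 0)).sub
    (((hasDerivAt_modulus_deriv_line K A r s 0).mul
      ((hG.hasDerivAt_comp_line x a 0).mul (hG.hasDerivAt_comp_line y b 0))).add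
     ((hasDerivAt_modulus_line K A r s 0).mul
      (((hG.hasDerivAt_fderiv_comp_line x a 0).mul (hG.hasDerivAt_comp_line y b 0)).add
       ((hG.hasDerivAt_comp_line x a 0).mul (hG.hasDerivAt_fderiv_comp_line y b 0)))))
  have h3 := hqmax.second_hasDerivAt_nonpos (Eventually.of_forall h1) h2
  simp only [zero_smul, add_zero, mul_zero, Pi.mul_apply, Pi.add_apply] at h3
  linarith

theorem norm_sub_line {E : Type*} [NormedAddCommGroup E] [NormedSpace ℝ E] {x y : E} (hxy : x ≠ y) :
    ∀ᶠ t in 𝓝 (0 : ℝ), ‖(x + t • (‖x - y‖⁻¹ • (x - y))) - (y + t • -(‖x - y‖⁻¹ • (x - y)))‖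
      = ‖x - y‖ + 2 * t := by
  have hr : 0 < ‖x - y‖ := norm_pos_iff.2 (sub_ne_zero.2 hxy)
  have : ∀ᶠ t in 𝓝 (0 : ℝ), -‖x - y‖ / 2 < t := lt_mem_nhds (by linarith)
  filter_upwards [this] with t ht
  have h : (x + t • (‖x - y‖⁻¹ • (x - y))) - (y + t • -(‖x - y‖⁻¹ • (x - y)))
      = ((‖x - y‖ + 2 * t) * ‖x - y‖⁻¹) • (x - y) := by
    have : (‖x - y‖ + 2 * t) * ‖x - y‖⁻¹ = 1 + 2 * (t * ‖x - y‖⁻¹) := by field_simp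
    rw [this]
    module
  rw [h, norm_smul, Real.norm_of_nonneg (mul_nonneg (by linarith) (inv_nonneg.2 hr.le))]
  field_simp

/-- The Euclidean gradient, written with the coordinate derivatives. -/
def gradVec (f : V2 → ℝ) (x : V2) : V2 := mkV (pd1 f x) (pd2 f x)

theorem eq_coord_smul_add (v : V2) : v = v 0 • ee1 + v 1 • ee2 := by
  ext i
  fin_cases i <;> simp [ee1, ee2]

theorem fderiv_apply_coord (f : V2 → ℝ) (x v : V2) :
    fderiv ℝ f x v = v 0 * pd1 f x + v 1 * pd2 f x := by
  conv_lhs => rw [eq_coord_smul_add v]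
  simp [pd1, pd2]

theorem inner_gradVec (f : V2 → ℝ) (x v : V2) : inner ℝ v (gradVec f x) = fderiv ℝ f x v := by
  rw [fderiv_apply_coord]
  simp [gradVec, mkV, PiLp.inner_apply, Fin.sum_univ_two, mul_comm]

theorem fderiv_gradVec (f : V2 → ℝ) (x : V2) :
    fderiv ℝ f x (gradVec f x) = ‖gradVec f x‖ ^ 2 := by
  rw [← inner_gradVec, real_inner_self_eq_norm_sq]

theorem gradVec_ne_zero {f : V2 → ℝ} {x : V2} (h : fderiv ℝ f x ≠ 0) : gradVec f x ≠ 0 := by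
  intro h0
  refine h (ContinuousLinearMap.ext fun v => ?_)
  rw [← inner_gradVec, h0]
  simp

theorem continuous_gradVec {f : V2 → ℝ} (hf : ContDiff ℝ 2 f) : Continuous (gradVec f) := by
  have h : Continuous (fderiv ℝ f) := hf.continuous_fderiv (by norm_num)
  have h1 : Continuous (pd1 f) := h.clm_apply continuous_const
  have h2 : Continuous (pd2 f) := h.clm_apply continuous_const
  refine (EuclideanSpace.equiv (Fin 2) ℝ).symm.continuous.comp (continuous_pi fun i => ?_)
  fin_cases i
  · exact h1
  · exact h2

theorem hasDerivAt_norm_line {x y w : V2} (hxy : x ≠ y) :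
    HasDerivAt (fun t : ℝ => ‖x + t • w - y‖) (inner ℝ (x - y) w / ‖x - y‖) 0 := by
  have hr : ‖x - y‖ ≠ 0 := norm_ne_zero_iff.2 (sub_ne_zero.2 hxy)
  have h1 := ((hasDerivAt_line x w 0).sub_const y).norm_sq
  have h2 := h1.sqrt (by simpa using hr)
  simp only [Real.sqrt_sq (norm_nonneg _), zero_smul, add_zero] at h2
  refine h2.congr_deriv ?_
  field_simp

/-- At a boundary point the weight forces the doubling functional to increase strictly in the
inward normal direction. -/
theorem eventually_lt_inward {u G f : V2 → ℝ} (hu : ContDiff ℝ 2 u) (hG : ContDiff ℝ 2 G)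
    {K A m μ c : ℝ} {x y : V2} (hxy : x ≠ y) (hun : fderiv ℝ u x (gradVec f x) = 0)
    (hGn : fderiv ℝ G x (gradVec f x) = G x * (μ * ‖gradVec f x‖ ^ 2)) (hGx : 0 < G x)
    (hc : 0 < c) (hK : 0 < K) (hA : 0 < A) (hr : ‖x - y‖ ≤ 1 / (4 * A))
    (hm : 0 ≤ m) (hcvx : -m * ‖x - y‖ ^ 2 ≤ fderiv ℝ f x (x - y))
    (hμ : m < μ * ‖gradVec f x‖ ^ 2) :
    ∀ᶠ t in 𝓝[>] (0 : ℝ), u x - modulus K A ‖x - y‖ * (G x * c) <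
      u (x + t • -gradVec f x)
        - modulus K A ‖x + t • -gradVec f x - y‖ * (G (x + t • -gradVec f x) * c) := by
  set n := gradVec f x with hn
  have hr0 : 0 < ‖x - y‖ := norm_pos_iff.2 (sub_ne_zero.2 hxy)
  have hmod : HasDerivAt (fun t : ℝ => modulus K A ‖x + t • -n - y‖)
      (K * (1 - 2 * A * ‖x - y‖) * (inner ℝ (x - y) (-n) / ‖x - y‖)) 0 := by
    have h := hasDerivAt_modulus K A ‖x + (0 : ℝ) • -n - y‖
    refine (h.comp (0 : ℝ) (hasDerivAt_norm_line hxy (w := -n))).congr_deriv ?_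
    simp
  have hd := (hu.hasDerivAt_comp_line x (-n) 0).sub
    (hmod.mul ((hG.hasDerivAt_comp_line x (-n) 0).mul_const c))
  have key := eventually_gt_right_of_hasDerivAt_pos hd ?_
  · simpa using key
  simp only [zero_smul, add_zero, map_neg, hun, hGn, inner_neg_right]
  rw [hn, inner_gradVec, ← hn]
  set r := ‖x - y‖
  have hAr : A * r ≤ 1 / 4 := by
    rw [le_div_iff₀ (by positivity)] at hr
    linarith
  have hdiv : -m * r ≤ fderiv ℝ f x (x - y) / r := by
    rw [le_div_iff₀ hr0]
    linarith
  have h1 : (1 - 2 * A * r) * (-m * r) ≤ (1 - 2 * A * r) * (fderiv ℝ f x (x - y) / r) :=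
    mul_le_mul_of_nonneg_left hdiv (by linarith)
  have h2 : (r - A * r ^ 2) * m < (r - A * r ^ 2) * (μ * ‖n‖ ^ 2) :=
    mul_lt_mul_of_pos_left hμ (by nlinarith)
  have h3 : 0 ≤ m * (A * r ^ 2) := by positivity
  have h4 : 0 < (1 - 2 * A * r) * (fderiv ℝ f x (x - y) / r)
      + (r - A * r ^ 2) * (μ * ‖n‖ ^ 2) := by nlinarith
  have h5 := mul_pos (mul_pos (mul_pos hK hGx) hc) h4
  simp only [modulus]
  rw [neg_div]
  linarith

theorem eventually_lt_of_inward {f : V2 → ℝ} (hf : ContDiff ℝ 2 f) {x : V2}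
    (hn : gradVec f x ≠ 0) : ∀ᶠ t in 𝓝[>] (0 : ℝ), f (x + t • -gradVec f x) < f x := by
  have h := eventually_gt_right_of_hasDerivAt_pos (hf.hasDerivAt_comp_line x (-gradVec f x) 0).neg ?_
  · simpa using h
  · rw [map_neg, neg_neg, zero_smul, add_zero, fderiv_gradVec]
    have := norm_pos_iff.2 hn
    positivity

theorem pd_pd_eq {u : V2 → ℝ} (hu : ContDiff ℝ 2 u) (x : V2) :
    pd1 (pd1 u) x + pd2 (pd2 u) x
      = fderiv ℝ (fderiv ℝ u) x ee1 ee1 + fderiv ℝ (fderiv ℝ u) x ee2 ee2 := by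
  have h1 : DifferentiableAt ℝ (fderiv ℝ u) x :=
    (hu.fderiv_right (m := 1) (by norm_num)).differentiable (by norm_num) x
  have h (e : V2) : fderiv ℝ (fun y => fderiv ℝ u y e) x e = fderiv ℝ (fderiv ℝ u) x e e := by
    rw [fderiv_clm_apply h1 (differentiableAt_const e)]
    simp
  exact congr_arg₂ (· + ·) (h ee1) (h ee2)

/-- The trace of a bilinear form on the plane is invariant under rotation of the frame. -/
theorem trace_rotate (B : V2 →L[ℝ] V2 →L[ℝ] ℝ) {e : V2} (he : ‖e‖ = 1) :
    B e e + B (mkV (-e 1) (e 0)) (mkV (-e 1) (e 0)) = B ee1 ee1 + B ee2 ee2 := by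
  have h1 : e 0 ^ 2 + e 1 ^ 2 = 1 := by
    have := EuclideanSpace.norm_sq_eq e
    rw [he] at this
    simpa [Fin.sum_univ_two] using this.symm
  have h2 : mkV (-e 1) (e 0) = (-e 1) • ee1 + e 0 • ee2 := by
    simpa [mkV] using eq_coord_smul_add (mkV (-e 1) (e 0))
  rw [h2]
  nth_rewrite 1 [eq_coord_smul_add e]
  nth_rewrite 3 [eq_coord_smul_add e]
  simp only [map_add, map_smul, map_neg, neg_smul, add_apply,
    smul_apply, neg_apply, smul_eq_mul]
  linear_combination (B ee1 ee1 + B ee2 ee2) * h1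

theorem norm_mkV_rotate (e : V2) : ‖mkV (-e 1) (e 0)‖ = ‖e‖ := by
  simp [EuclideanSpace.norm_eq, mkV, Fin.sum_univ_two, add_comm]

theorem abs_mul_le_sq {p q M : ℝ} (hp : |p| ≤ M) (hq : |q| ≤ M) : |p * q| ≤ M ^ 2 := by
  rw [abs_mul, sq]
  exact mul_le_mul hp hq (abs_nonneg _) ((abs_nonneg _).trans hp)

theorem abs_apply_le {L : V2 →L[ℝ] ℝ} {M : ℝ} (hL : ‖L‖ ≤ M) {a : V2} (ha : ‖a‖ = 1) :
    |L a| ≤ M := by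
  have := L.le_of_opNorm_le hL a
  rwa [ha, mul_one, Real.norm_eq_abs] at this

theorem abs_apply_apply_le {B : V2 →L[ℝ] V2 →L[ℝ] ℝ} {M : ℝ} (hB : ‖B‖ ≤ M) {a : V2}
    (ha : ‖a‖ = 1) : |B a a| ≤ M := by
  refine abs_apply_le ?_ ha
  have := B.le_of_opNorm_le hB a
  rwa [ha, mul_one] at this

/-- Bounds on a positive weight and its first two derivatives at a point. -/
structure WeightBound (G : V2 → ℝ) (g M : ℝ) (x : V2) : Prop where
  le : g ≤ G x
  abs_le : |G x| ≤ M
  fderiv_le : ‖fderiv ℝ G x‖ ≤ M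
  fderiv_fderiv_le : ‖fderiv ℝ (fderiv ℝ G) x‖ ≤ M

/-- At an off-diagonal interior maximum, the difference of the Laplacians is controlled by
the modulus of continuity. -/
theorem laplacian_sub_le_of_isLocalMax {u G : V2 → ℝ} (hu : ContDiff ℝ 2 u)
    (hG : ContDiff ℝ 2 G) {K A g M : ℝ} {x y : V2} (hK : 0 < K) (hA : 1 ≤ A) (hg : 0 < g)
    (hx : WeightBound G g M x) (hy : WeightBound G g M y) (hxy : x ≠ y)
    (hr : ‖x - y‖ ≤ 1 / (4 * A)) (hmax : IsLocalMax (doubling u G K A) (x, y)) :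
    (pd1 (pd1 u) x + pd2 (pd2 u) x) - (pd1 (pd1 u) y + pd2 (pd2 u) y)
      ≤ -8 * A * K * g ^ 2 + 16 * K * M ^ 2 := by
  have hr0 : 0 < ‖x - y‖ := norm_pos_iff.2 (sub_ne_zero.2 hxy)
  set e := ‖x - y‖⁻¹ • (x - y) with he
  have he1 : ‖e‖ = 1 := by
    rw [he, norm_smul, norm_inv, norm_norm, inv_mul_cancel₀ hr0.ne']
  have hw1 : ‖mkV (-e 1) (e 0)‖ = 1 := (norm_mkV_rotate e).trans he1
  set w := mkV (-e 1) (e 0) with hw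
  have h1 := doubling_second_order hu hG hmax (norm_sub_line hxy)
  have h2 := doubling_second_order hu hG hmax (a := w) (b := w) (s := 0)
    (Eventually.of_forall fun t => by simp)
  rw [← he] at h1
  rw [pd_pd_eq hu, pd_pd_eq hu, ← trace_rotate _ he1, ← trace_rotate _ he1, ← hw]
  simp only [map_neg, neg_apply, neg_neg] at h1
  set r := ‖x - y‖
  have hAr : A * r ≤ 1 / 4 := by
    rw [le_div_iff₀ (by positivity)] at hr
    linarith
  have hmod0 : 0 ≤ modulus K A r := by
    unfold modulus
    have : 0 ≤ r - A * r ^ 2 := by nlinarith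
    positivity
  have hmod1 : modulus K A r ≤ K := by
    unfold modulus
    have : r - A * r ^ 2 ≤ 1 := by nlinarith
    nlinarith
  have hslope0 : 0 ≤ K * (1 - 2 * A * r) := mul_nonneg hK.le (by linarith)
  have hslope1 : K * (1 - 2 * A * r) ≤ K := by nlinarith [mul_pos (mul_pos hK (by linarith : 0 < A)) hr0]
  have hgg : g ^ 2 ≤ G x * G y := by
    rw [sq]
    exact mul_le_mul hx.le hy.le hg.le (hg.le.trans hx.le)
  have hAK : 8 * A * K * g ^ 2 ≤ 8 * A * K * (G x * G y) :=
    mul_le_mul_of_nonneg_left hgg (by positivity)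
  have dx := abs_apply_le hx.fderiv_le he1
  have dy := abs_apply_le hy.fderiv_le he1
  have dxw := abs_apply_le hx.fderiv_le hw1
  have dyw := abs_apply_le hy.fderiv_le hw1
  have a1 := abs_le.1 (abs_mul_le_sq dx hy.abs_le)
  have a2 := abs_le.1 (abs_mul_le_sq hx.abs_le dy)
  have a3 := abs_le.1 (abs_mul_le_sq (abs_apply_apply_le hx.fderiv_fderiv_le he1) hy.abs_le)
  have a4 := abs_le.1 (abs_mul_le_sq dx dy)
  have a5 := abs_le.1 (abs_mul_le_sq hx.abs_le (abs_apply_apply_le hy.fderiv_fderiv_le he1))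
  have a6 := abs_le.1 (abs_mul_le_sq (abs_apply_apply_le hx.fderiv_fderiv_le hw1) hy.abs_le)
  have a7 := abs_le.1 (abs_mul_le_sq dxw dyw)
  have a8 := abs_le.1 (abs_mul_le_sq hx.abs_le (abs_apply_apply_le hy.fderiv_fderiv_le hw1))
  have scale {p s q : ℝ} (hp : 0 ≤ p) (hpK : p ≤ K) (hs : s ≤ q) (hq : 0 ≤ q) :
      p * s ≤ K * q :=
    (mul_le_mul_of_nonneg_left hs hp).trans (mul_le_mul_of_nonneg_right hpK hq)
  have hM : 0 ≤ M ^ 2 := sq_nonneg M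
  have b1 := scale (s := fderiv ℝ G x e * G y + G x * -fderiv ℝ G y e) hslope0 hslope1
    (show _ ≤ 2 * M ^ 2 by linarith) (by positivity)
  have b2 := scale hmod0 hmod1 (show fderiv ℝ (fderiv ℝ G) x e e * G y
    + 2 * (fderiv ℝ G x e * -fderiv ℝ G y e) + G x * fderiv ℝ (fderiv ℝ G) y e e ≤ 4 * M ^ 2
      by linarith) (by positivity)
  have b3 := scale hmod0 hmod1 (show fderiv ℝ (fderiv ℝ G) x w w * G y
    + 2 * (fderiv ℝ G x w * fderiv ℝ G y w) + G x * fderiv ℝ (fderiv ℝ G) y w w ≤ 4 * M ^ 2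
      by linarith) (by positivity)
  linarith

/-- A domain `{f < 0}` with the quantitative one-sided regularity of its boundary. -/
structure RegularDomain (Ω : Set V2) (f : V2 → ℝ) (c m : ℝ) : Prop where
  isOpen : IsOpen Ω
  isBounded : Bornology.IsBounded Ω
  contDiff : ContDiff ℝ 2 f
  eq_set : Ω = {x | f x < 0}
  m_nonneg : 0 ≤ m
  c_pos : 0 < c
  grad_ge : ∀ x ∈ frontier Ω, c ≤ ‖gradVec f x‖ ^ 2
  semiconvex : ∀ x ∈ frontier Ω, ∀ y ∈ closure Ω, -m * ‖x - y‖ ^ 2 ≤ fderiv ℝ f x (x - y)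

theorem RegularDomain.eventually_mem {Ω : Set V2} {f : V2 → ℝ} {c m : ℝ}
    (hΩ : RegularDomain Ω f c m) {x : V2} (hx : x ∈ frontier Ω) :
    ∀ᶠ t in 𝓝[>] (0 : ℝ), x + t • -gradVec f x ∈ Ω := by
  have hn : gradVec f x ≠ 0 := fun h => by
    have := hΩ.grad_ge x hx
    rw [h] at this
    simp only [norm_zero] at this
    linarith [hΩ.c_pos]
  have hf0 : f x = 0 := by
    have := hx
    rw [hΩ.eq_set] at this
    exact frontier_lt_subset_eq hΩ.contDiff.continuous continuous_const this
  filter_upwards [eventually_lt_of_inward hΩ.contDiff hn] with t ht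
  rw [hΩ.eq_set]
  exact ht.trans_eq hf0

/-- A maximum of the doubling functional in one variable cannot lie on the boundary. -/
theorem RegularDomain.mem_of_isMaxOn {Ω : Set V2} {f : V2 → ℝ} {c m μ K A d : ℝ}
    (hΩ : RegularDomain Ω f c m) {u G : V2 → ℝ} (hu : ContDiff ℝ 2 u) (hG : ContDiff ℝ 2 G)
    (hμ : m < μ * c)
    (hGn : ∀ x ∈ frontier Ω,
      fderiv ℝ G x (gradVec f x) = G x * (μ * ‖gradVec f x‖ ^ 2))
    (hGp : ∀ x ∈ closure Ω, 0 < G x) (hd : 0 < d) (hK : 0 < K) (hA : 0 < A)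
    (hun : ∀ x ∈ frontier Ω, fderiv ℝ u x (gradVec f x) = 0) {p q : V2}
    (hp : p ∈ closure Ω) (hq : q ∈ closure Ω) (hne : p ≠ q) (hlt : ‖p - q‖ < 1 / (4 * A))
    (hmax : ∀ z ∈ closure Ω, ‖z - q‖ ≤ 1 / (4 * A) →
      u z - modulus K A ‖z - q‖ * (G z * d) ≤ u p - modulus K A ‖p - q‖ * (G p * d)) :
    p ∈ Ω := by
  by_contra hpn
  have hpf : p ∈ frontier Ω := by
    rw [hΩ.isOpen.frontier_eq]
    exact ⟨hp, hpn⟩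
  have hμ0 : 0 < μ := by
    by_contra! hneg
    nlinarith [hΩ.c_pos, hΩ.m_nonneg]
  have hμ' : m < μ * ‖gradVec f p‖ ^ 2 :=
    hμ.trans_le (mul_le_mul_of_nonneg_left (hΩ.grad_ge p hpf) hμ0.le)
  have hline : Tendsto (fun t : ℝ => p + t • -gradVec f p) (𝓝[>] 0) (𝓝 p) := by
    have : Continuous fun t : ℝ => p + t • -gradVec f p := by fun_prop
    simpa using (this.tendsto 0).mono_left nhdsWithin_le_nhds
  have hdist : ∀ᶠ z in 𝓝 p, ‖z - q‖ < 1 / (4 * A) :=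
    (by fun_prop : Continuous fun z => ‖z - q‖).continuousAt.eventually_lt_const hlt
  obtain ⟨t, h1, h2, h3⟩ := ((eventually_lt_inward hu hG hne (hun p hpf) (hGn p hpf)
    (hGp p hp) hd hK hA hlt.le hΩ.m_nonneg (hΩ.semiconvex p hpf q hq) hμ').and
      ((hΩ.eventually_mem hpf).and (hline.eventually hdist))).exists
  exact (hmax _ (subset_closure h2) h3.le).not_gt h1

/-- The comparison estimate: the doubling functional is nonpositive near the diagonal. -/
theorem RegularDomain.doubling_nonpos {Ω : Set V2} {f : V2 → ℝ} {c m μ g M K A L : ℝ}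
    (hΩ : RegularDomain Ω f c m) {u G : V2 → ℝ} (hu : ContDiff ℝ 2 u) (hG : ContDiff ℝ 2 G)
    (hμ : m < μ * c)
    (hGn : ∀ x ∈ frontier Ω,
      fderiv ℝ G x (gradVec f x) = G x * (μ * ‖gradVec f x‖ ^ 2))
    (hGb : ∀ x ∈ closure Ω, WeightBound G g M x) (hg : 0 < g) (hK : 0 < K) (hA : 1 ≤ A)
    (hun : ∀ x ∈ frontier Ω, fderiv ℝ u x (gradVec f x) = 0)
    (hosc : ∀ x ∈ closure Ω, ∀ y ∈ closure Ω, u x - u y ≤ 1)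
    (hlap : ∀ x ∈ Ω, |pd1 (pd1 u) x + pd2 (pd2 u) x| ≤ L)
    (hKA : 2 * L < 8 * A * K * g ^ 2 - 16 * K * M ^ 2)
    (hend : 1 ≤ modulus K A (1 / (4 * A)) * g ^ 2)
    {x y : V2} (hx : x ∈ closure Ω) (hy : y ∈ closure Ω) (hxy : ‖x - y‖ ≤ 1 / (4 * A)) :
    doubling u G K A (x, y) ≤ 0 := by
  by_contra! hpos
  have hGp : ∀ z ∈ closure Ω, 0 < G z := fun z hz => hg.trans_le (hGb z hz).le
  let S : Set (V2 × V2) := (closure Ω ×ˢ closure Ω) ∩ {p | ‖p.1 - p.2‖ ≤ 1 / (4 * A)}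
  have hScpt : IsCompact S := by
    refine (hΩ.isBounded.isCompact_closure.prod hΩ.isBounded.isCompact_closure).inter_right ?_
    exact isClosed_le (by fun_prop) continuous_const
  have hcont : Continuous (doubling u G K A) := by
    have := hu.continuous
    have := hG.continuous
    unfold doubling modulus
    fun_prop
  obtain ⟨⟨p, q⟩, ⟨⟨hp, hq⟩, hpq⟩, hmax⟩ :=
    hScpt.exists_isMaxOn ⟨(x, y), ⟨hx, hy⟩, hxy⟩ hcont.continuousOn
  simp only at hp hq
  have hpos' : 0 < doubling u G K A (p, q) := hpos.trans_le (hmax ⟨⟨hx, hy⟩, hxy⟩)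
  have hne : p ≠ q := by
    rintro rfl
    simp [doubling, modulus] at hpos'
  have hlt : ‖p - q‖ < 1 / (4 * A) := by
    refine lt_of_le_of_ne hpq fun heq => ?_
    have h0 : 0 ≤ modulus K A (1 / (4 * A)) := by
      by_contra! hneg
      nlinarith [sq_nonneg g]
    have h1 : g ^ 2 ≤ G p * G q := by
      rw [sq]
      exact mul_le_mul (hGb p hp).le (hGb q hq).le hg.le (hGp p hp).le
    have h2 := mul_le_mul_of_nonneg_left h1 h0
    have h3 := hosc p hp q hq
    simp only [doubling, heq] at hpos'
    linarith
  have hpΩ : p ∈ Ω := by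
    refine hΩ.mem_of_isMaxOn hu hG hμ hGn hGp (hGp q hq) hK (by linarith) hun hp hq hne hlt
      fun z hz hzq => ?_
    have h : doubling u G K A (z, q) ≤ doubling u G K A (p, q) := hmax ⟨⟨hz, hq⟩, hzq⟩
    simp only [doubling] at h
    linarith
  have hqΩ : q ∈ Ω := by
    refine hΩ.mem_of_isMaxOn (u := -u) (A := A) hu.neg hG hμ hGn hGp (hGp p hp) hK (by linarith)
      (fun z hz => by rw [fderiv_neg, neg_apply, hun z hz, neg_zero]) hq hp hne.symm
      (by rwa [norm_sub_rev]) fun z hz hzp => ?_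
    have h : doubling u G K A (p, z) ≤ doubling u G K A (p, q) :=
      hmax ⟨⟨hp, hz⟩, (norm_sub_rev p z).trans_le hzp⟩
    simp only [doubling] at h
    simp only [Pi.neg_apply, norm_sub_rev z p, norm_sub_rev q p]
    linarith
  have hloc : IsLocalMax (doubling u G K A) (p, q) := by
    have h1 : ∀ᶠ z : V2 × V2 in 𝓝 (p, q), ‖z.1 - z.2‖ < 1 / (4 * A) :=
      (by fun_prop : Continuous fun z : V2 × V2 => ‖z.1 - z.2‖).continuousAt.eventually_lt_const
        hlt
    filter_upwards [h1, (hΩ.isOpen.prod hΩ.isOpen).mem_nhds ⟨hpΩ, hqΩ⟩] with z hz1 hz2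
    exact hmax ⟨⟨subset_closure hz2.1, subset_closure hz2.2⟩, hz1.le⟩
  have hfin := laplacian_sub_le_of_isLocalMax hu hG hK hA hg (hGb p hp) (hGb q hq) hne hpq hloc
  have l1 := (abs_le.1 (hlap p hpΩ)).1
  have l2 := (abs_le.1 (hlap q hqΩ)).2
  linarith

theorem SmoothBdry.exists_regularDomain {Ω : Set V2} (sb : SmoothBdry Ω) (hΩo : IsOpen Ω)
    (hΩb : Bornology.IsBounded Ω) : ∃ c m : ℝ, RegularDomain Ω sb.f c m := by
  have hf : ContDiff ℝ 2 sb.f := contDiff_infty.1 sb.smooth 2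
  have hf' : ContDiff ℝ 1 (fderiv ℝ sb.f) := hf.fderiv_right (by norm_num)
  obtain ⟨R, hR⟩ := hΩb.closure.subset_closedBall (0 : V2)
  obtain ⟨m, hm⟩ := (isCompact_closedBall (0 : V2) R).exists_bound_of_continuousOn
    (hf'.continuous_fderiv (by norm_num)).continuousOn
  have hfr : IsCompact (frontier Ω) :=
    hΩb.isCompact_closure.of_isClosed_subset isClosed_frontier frontier_subset_closure
  obtain ⟨c, hc, hcle⟩ := hfr.exists_forall_le' (f := fun x => ‖gradVec sb.f x‖ ^ 2) (a := 0)
    ((continuous_gradVec hf).norm.pow 2).continuousOn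
    fun x hx => pow_pos (norm_pos_iff.2 (gradVec_ne_zero (sb.grad_ne x hx))) 2
  refine ⟨c, max m 0, hΩo, hΩb, hf, sb.eq_set, le_max_right _ _, hc, hcle, fun x hx y hy => ?_⟩
  have hfx : sb.f x = 0 := by
    have h := hx
    rw [sb.eq_set] at h
    exact frontier_lt_subset_eq hf.continuous continuous_const h
  have hfy : sb.f y ≤ 0 := by
    have h := hy
    rw [sb.eq_set] at h
    exact closure_lt_subset_le hf.continuous continuous_const h
  have hseg : segment ℝ x y ⊆ closedBall 0 R :=
    (convex_closedBall _ _).segment_subset (hR (frontier_subset_closure hx)) (hR hy)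
  have hlip : ∀ z ∈ segment ℝ x y, ‖fderiv ℝ sb.f z - fderiv ℝ sb.f x‖ ≤ max m 0 * ‖x - y‖ := by
    intro z hz
    have h1 := (convex_closedBall (0 : V2) R).norm_image_sub_le_of_norm_fderiv_le
      (fun w _ => hf'.differentiable (by norm_num) w) hm
      (hseg (left_mem_segment ℝ x y)) (hseg hz)
    have h2 : ‖z - x‖ ≤ ‖x - y‖ := by
      rw [norm_sub_rev x y]
      exact norm_sub_le_of_mem_segment hz
    exact h1.trans (mul_le_mul (le_max_left _ _) h2 (norm_nonneg _) (le_max_right _ _))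
  have h := (convex_segment x y).norm_image_sub_le_of_norm_fderiv_le'
    (fun w _ => hf.differentiable (by norm_num) w) hlip (left_mem_segment ℝ x y)
    (right_mem_segment ℝ x y)
  have h2 := (abs_le.1 h).1
  rw [norm_sub_rev y x, hfx, ← neg_sub x y, map_neg] at h2
  linarith

theorem exists_weightBound {s : Set V2} (hs : IsCompact s) {G : V2 → ℝ} (hG : ContDiff ℝ 2 G)
    (hpos : ∀ x, 0 < G x) : ∃ g M : ℝ, 0 < g ∧ 0 < M ∧ ∀ x ∈ s, WeightBound G g M x := by
  have hG' : ContDiff ℝ 1 (fderiv ℝ G) := hG.fderiv_right (by norm_num)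
  obtain ⟨g, hg, hgle⟩ := hs.exists_forall_le' hG.continuous.continuousOn fun x _ => hpos x
  obtain ⟨M₀, h₀⟩ := hs.exists_bound_of_continuousOn hG.continuous.continuousOn
  obtain ⟨M₁, h₁⟩ := hs.exists_bound_of_continuousOn hG'.continuous.continuousOn
  obtain ⟨M₂, h₂⟩ := hs.exists_bound_of_continuousOn
    (hG'.continuous_fderiv (by norm_num)).continuousOn
  refine ⟨g, max (max M₀ 1) (max M₁ M₂), hg, by positivity, fun x hx => ⟨hgle x hx, ?_, ?_, ?_⟩⟩
  · exact (h₀ x hx).trans ((le_max_left _ _).trans (le_max_left _ _))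
  · exact (h₁ x hx).trans ((le_max_left _ _).trans (le_max_right _ _))
  · exact (h₂ x hx).trans ((le_max_right _ _).trans (le_max_right _ _))

theorem hasFDerivAt_exp_mul {f : V2 → ℝ} (hf : ContDiff ℝ 2 f) (μ : ℝ) (x : V2) :
    HasFDerivAt (fun x => Real.exp (μ * f x)) (Real.exp (μ * f x) • μ • fderiv ℝ f x) x :=
  ((hf.differentiable (by norm_num) x).hasFDerivAt.const_mul μ).exp

theorem fderiv_normal_eq_zero {Ω : Set V2} (sb : SmoothBdry Ω) {u : V2 → ℝ} {x : V2}
    (hx : x ∈ frontier Ω) (h : fderiv ℝ u x (sb.normal x) = 0) :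
    fderiv ℝ u x (gradVec sb.f x) = 0 := by
  have h' : ‖gradVec sb.f x‖⁻¹ * fderiv ℝ u x (gradVec sb.f x) = 0 := by
    rw [← smul_eq_mul, ← map_smul]
    exact h
  exact (mul_eq_zero.1 h').resolve_left
    (inv_ne_zero (norm_ne_zero_iff.2 (gradVec_ne_zero (sb.grad_ne x hx))))

/-- A Lipschitz bound near the diagonal bounds the derivative up to the boundary. -/
theorem norm_fderiv_le_of_local_lipschitz {Ω : Set V2} (hΩ : IsOpen Ω) {u : V2 → ℝ}
    (hu : ContDiff ℝ 2 u) {r L : ℝ} (hr : 0 < r) (hL : 0 ≤ L)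
    (h : ∀ x ∈ closure Ω, ∀ y ∈ closure Ω, ‖x - y‖ ≤ r → u x - u y ≤ L * ‖x - y‖) {x : V2}
    (hx : x ∈ closure Ω) : ‖fderiv ℝ u x‖ ≤ L := by
  have hclosed : IsClosed {x | ‖fderiv ℝ u x‖ ≤ L} :=
    isClosed_le (hu.continuous_fderiv (by norm_num)).norm continuous_const
  refine closure_minimal (fun z hz => ?_) hclosed hx
  refine (hu.differentiable (by norm_num) z).hasFDerivAt.le_of_lip' hL ?_
  filter_upwards [hΩ.mem_nhds hz, closedBall_mem_nhds z hr] with w hw hwr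
  rw [mem_closedBall, dist_eq_norm] at hwr
  have h1 := h w (subset_closure hw) z (subset_closure hz) hwr
  have h2 := h z (subset_closure hz) w (subset_closure hw) (by rwa [norm_sub_rev])
  rw [norm_sub_rev] at h2
  exact abs_le.2 ⟨by linarith, h1⟩

/-- the gradient bound ‖∇ρ‖_∞ ≤ C/ε for classical Neumann solutions. -/
theorem statement2
    (Ω : Set V2) (hΩo : IsOpen Ω) (hΩb : Bornology.IsBounded Ω)
    (sb : SmoothBdry Ω)
    (b : ℝ) (hb : b ∈ Set.Ioo (0 : ℝ) 1) :
    ∃ C > 0, ∀ (ε : ℝ), ε ∈ Set.Ioc (0 : ℝ) 1 →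
      ∀ (a : V2 → ℝ), ContinuousOn a (closure Ω) →
        (∀ x ∈ closure Ω, b ≤ a x ∧ a x ≤ 1) →
      ∀ (ρ : V2 → ℝ), ContDiff ℝ 2 ρ → (∀ x ∈ closure Ω, 0 ≤ ρ x ∧ ρ x ≤ 1) →
        (∀ x ∈ Ω, -(pd1 (pd1 ρ) x + pd2 (pd2 ρ) x) = ρ x * (a x - ρ x ^ 2) / ε ^ 2) →
        (∀ x ∈ frontier Ω, fderiv ℝ ρ x (sb.normal x) = 0) →
        ∀ x ∈ closure Ω, ‖fderiv ℝ ρ x‖ ≤ C / ε := by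
  obtain ⟨c, m, hΩ⟩ := sb.exists_regularDomain hΩo hΩb
  obtain ⟨μ, hμ⟩ : ∃ μ : ℝ, m < μ * c :=
    ⟨(m + 1) / c, by rw [div_mul_cancel₀ _ hΩ.c_pos.ne']; linarith⟩
  have hG : ContDiff ℝ 2 fun x => Real.exp (μ * sb.f x) :=
    (contDiff_const.mul hΩ.contDiff).exp
  obtain ⟨g, M, hg, hM, hGb⟩ := exists_weightBound hΩb.isCompact_closure hG
    fun x => Real.exp_pos _
  set G : V2 → ℝ := fun x => Real.exp (μ * sb.f x) with hGdef
  have hGn : ∀ x, fderiv ℝ G x (gradVec sb.f x) = G x * (μ * ‖gradVec sb.f x‖ ^ 2) := by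
    intro x
    rw [(hasFDerivAt_exp_mul hΩ.contDiff μ x).fderiv, ← fderiv_gradVec]
    simp [hGdef]
  set A₀ : ℝ := (2 * M ^ 2 + 1) / g ^ 2 + 1 with hA₀
  set K₀ : ℝ := 6 * A₀ / g ^ 2 + 1 with hK₀
  have hA₀1 : 1 ≤ A₀ := le_add_of_nonneg_left (by positivity)
  have hK₀1 : 1 ≤ K₀ := le_add_of_nonneg_left (by positivity)
  have hA₀g : 2 * M ^ 2 + 1 ≤ A₀ * g ^ 2 := by
    rw [hA₀, add_mul, div_mul_cancel₀ _ (by positivity)]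
    nlinarith [sq_nonneg g]
  have hK₀g : 6 * A₀ ≤ K₀ * g ^ 2 := by
    rw [hK₀, add_mul, div_mul_cancel₀ _ (by positivity)]
    nlinarith [sq_nonneg g]
  refine ⟨K₀ * M ^ 2, by positivity, fun ε hε a _ ha ρ hρ hρ01 hpde hneu x hx => ?_⟩
  obtain ⟨hε0, hε1⟩ := hε
  have hA : 1 ≤ A₀ / ε := by
    rw [le_div_iff₀ hε0]
    linarith
  have hlap : ∀ z ∈ Ω, |pd1 (pd1 ρ) z + pd2 (pd2 ρ) z| ≤ 1 / ε ^ 2 := by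
    intro z hz
    obtain ⟨ha1, ha2⟩ := ha z (subset_closure hz)
    obtain ⟨h0, h1⟩ := hρ01 z (subset_closure hz)
    rw [← abs_neg, hpde z hz, abs_div, abs_of_pos (pow_pos hε0 2)]
    gcongr
    have := hb.1
    have h2 : |a z - ρ z ^ 2| ≤ 1 := abs_le.2 ⟨by nlinarith, by nlinarith⟩
    rw [abs_mul, abs_of_nonneg h0]
    exact mul_le_one₀ h1 (abs_nonneg _) h2
  have hKA : 2 * (1 / ε ^ 2)
      < 8 * (A₀ / ε) * (K₀ / ε) * g ^ 2 - 16 * (K₀ / ε) * M ^ 2 := by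
    have h1 : 16 * (K₀ * ε) * M ^ 2 ≤ 16 * K₀ * M ^ 2 := by
      gcongr
      nlinarith
    have h2 : K₀ * (2 * M ^ 2 + 1) ≤ K₀ * (A₀ * g ^ 2) := by gcongr
    have h3 : 2 < 8 * A₀ * K₀ * g ^ 2 - 16 * (K₀ * ε) * M ^ 2 := by linarith
    have h4 : 8 * (A₀ / ε) * (K₀ / ε) * g ^ 2 - 16 * (K₀ / ε) * M ^ 2
        = (8 * A₀ * K₀ * g ^ 2 - 16 * (K₀ * ε) * M ^ 2) / ε ^ 2 := by field_simp
    rw [h4, mul_one_div]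
    gcongr
  have hend : 1 ≤ modulus (K₀ / ε) (A₀ / ε) (1 / (4 * (A₀ / ε))) * g ^ 2 := by
    have h1 : modulus (K₀ / ε) (A₀ / ε) (1 / (4 * (A₀ / ε))) * g ^ 2
        = 3 * (K₀ * g ^ 2) / (16 * A₀) := by
      unfold modulus
      field_simp
      norm_num
    rw [h1, le_div_iff₀ (by positivity)]
    linarith
  refine norm_fderiv_le_of_local_lipschitz hΩo hρ (r := 1 / (4 * (A₀ / ε))) (by positivity)
    (by positivity) (fun y hy z hz hyz => ?_) hx
  have h := hΩ.doubling_nonpos hρ hG hμ (fun w _ => hGn w) hGb hg (by positivity : 0 < K₀ / ε) hA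
    (fun w hw => fderiv_normal_eq_zero sb hw (hneu w hw))
    (fun v hv w hw => by linarith [(hρ01 v hv).2, (hρ01 w hw).1]) hlap hKA hend hy hz hyz
  have hmod : modulus (K₀ / ε) (A₀ / ε) ‖y - z‖ ≤ K₀ / ε * ‖y - z‖ := by
    unfold modulus
    gcongr
    exact sub_le_self _ (by positivity)
  have hGG : G y * G z ≤ M ^ 2 := (le_abs_self _).trans
    (abs_mul_le_sq (hGb y hy).abs_le (hGb z hz).abs_le)
  have hGG0 : 0 ≤ G y * G z := by positivity
  have hfin := mul_le_mul hmod hGG hGG0 (by positivity)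
  simp only [doubling] at h
  calc ρ y - ρ z ≤ K₀ / ε * ‖y - z‖ * M ^ 2 := by linarith
    _ = K₀ * M ^ 2 / ε * ‖y - z‖ := by ring
end
end

section
/- Let Ω ⊂ ℝ² be a bounded open set with smooth boundary, b ∈ (0,1), ε > 0, and a ∈ C¹(clos(Ω); ℝ) with b ≤ a ≤ 1. Suppose ρ ∈ C¹(clos(Ω); ℝ) satisfies E_ε(ρ) ≤ E_ε(√a) (in particular this holds for any minimizer ρ of E_ε). Then there exists a constant C > 0, depending only on b, such that ‖∇ρ‖_{L²(Ω)} ≤ C ‖∇a‖_{L²(Ω)}. -/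
noncomputable section

open MeasureTheory

/-- The squared gradient of a `C¹` function is continuous. -/
theorem continuous_gradSq {v : V2 → ℝ} (hv : ContDiff ℝ 1 v) : Continuous (gradSq v) := by
  have h := hv.continuous_fderiv one_ne_zero
  unfold gradSq pd1 pd2
  fun_prop

/-- The squared gradient is nonnegative. -/
theorem gradSq_nonneg (v : V2 → ℝ) (x : V2) : 0 ≤ gradSq v x := by
  unfold gradSq
  positivity

/-- A continuous function is integrable on a bounded set. -/
theorem Continuous.integrableOn_of_isBounded_s3 {Ω : Set V2} (hΩ : Bornology.IsBounded Ω)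
    {g : V2 → ℝ} (hg : Continuous g) : IntegrableOn g Ω :=
  (hg.continuousOn.integrableOn_compact hΩ.isCompact_closure).mono_set subset_closure

/-- Chain rule for the squared gradient of a square root. -/
theorem gradSq_sqrt {a : V2 → ℝ} {x : V2} (ha : DifferentiableAt ℝ a x) (hx : 0 < a x) :
    gradSq (fun y => Real.sqrt (a y)) x = gradSq a x / (4 * a x) := by
  have hs : Real.sqrt (a x) ^ 2 = a x := Real.sq_sqrt hx.le
  unfold gradSq pd1 pd2
  rw [(ha.hasFDerivAt.sqrt hx.ne').fderiv]
  simp only [smul_apply, smul_eq_mul, mul_pow, div_pow, hs]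
  field_simp
  ring

/-- the L² gradient bound ‖∇ρ‖_{L²} ≤ C ‖∇a‖_{L²}. -/
theorem statement3 (b : ℝ) (hb : b ∈ Set.Ioo (0 : ℝ) 1) :
    ∃ C > 0, ∀ (Ω : Set V2), IsOpen Ω → Bornology.IsBounded Ω → Nonempty (SmoothBdry Ω) →
      ∀ (ε : ℝ), 0 < ε →
      ∀ (a : V2 → ℝ), ContDiff ℝ 1 a → (∀ x ∈ closure Ω, b ≤ a x ∧ a x ≤ 1) →
      ∀ (ρ : V2 → ℝ), ContDiff ℝ 1 ρ →
        Eeps Ω a ε ρ ≤ Eeps Ω a ε (fun x => Real.sqrt (a x)) →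
        Real.sqrt (∫ x in Ω, gradSq ρ x) ≤ C * Real.sqrt (∫ x in Ω, gradSq a x) := by
  obtain ⟨hb0, -⟩ := hb
  refine ⟨Real.sqrt (1 / (4 * b)), by positivity, ?_⟩
  intro Ω hΩ hbd _ ε _ a ha hab ρ hρ hE
  rw [← Real.sqrt_mul (by positivity)]
  apply Real.sqrt_le_sqrt
  have hpot : Continuous fun x => (a x - ρ x ^ 2) ^ 2 / (2 * ε ^ 2) :=
    (((ha.continuous.sub (hρ.continuous.pow 2)).pow 2).div_const _)
  have hlow : ∫ x in Ω, gradSq ρ x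
      ≤ ∫ x in Ω, (gradSq ρ x + (a x - ρ x ^ 2) ^ 2 / (2 * ε ^ 2)) := by
    refine integral_mono ((continuous_gradSq hρ).integrableOn_of_isBounded_s3 hbd)
      (((continuous_gradSq hρ).add hpot).integrableOn_of_isBounded_s3 hbd) fun x => ?_
    have : 0 ≤ (a x - ρ x ^ 2) ^ 2 / (2 * ε ^ 2) := by positivity
    simpa using this
  have hupp : ∫ x in Ω, (gradSq (fun y => Real.sqrt (a y)) x
      + (a x - Real.sqrt (a x) ^ 2) ^ 2 / (2 * ε ^ 2)) ≤ ∫ x in Ω, 1 / (4 * b) * gradSq a x := by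
    refine integral_mono_of_nonneg (.of_forall fun x => ?_)
      (((continuous_gradSq ha).const_mul _).integrableOn_of_isBounded_s3 hbd)
      (ae_restrict_of_forall_mem hΩ.measurableSet fun x hx => ?_)
    · exact add_nonneg (gradSq_nonneg _ _) (by positivity)
    · have hbx : b ≤ a x := (hab x (subset_closure hx)).1
      have hax : 0 < a x := hb0.trans_le hbx
      have hg := gradSq_nonneg a x
      simp only [Real.sq_sqrt hax.le, sub_self, gradSq_sqrt (ha.differentiable one_ne_zero x) hax]
      rw [one_div_mul_eq_div]
      simp only [ne_eq, OfNat.ofNat_ne_zero, not_false_eq_true, zero_pow, zero_div, add_zero]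
      gcongr
  rw [integral_const_mul] at hupp
  unfold Eeps at hE
  linarith
end
end

section
/- Let Ω ⊂ ℝ² be a bounded open set with smooth boundary, b ∈ (0,1), ε ∈ (0,1), and a ∈ C¹(clos(Ω); ℝ) with b ≤ a ≤ 1. Suppose ρ ∈ C¹(clos(Ω); ℝ) satisfies E_ε(ρ) ≤ E_ε(√a). For α ∈ (0,1) let X_α := { x ∈ Ω : |a(x) − ρ(x)²| > ε^α }. Then there exists a constant C > 0, depending only on b, such that the Lebesgue measure of X_α satisfies |X_α| ≤ C ‖∇a‖_{L²(Ω)}² ε^{2(1−α)}. -/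
noncomputable section

open MeasureTheory

/-- A continuous function is integrable on every bounded set. -/
theorem integrableOn_of_continuous_of_isBounded {s : Set V2} (hs : Bornology.IsBounded s)
    {f : V2 → ℝ} (hf : Continuous f) : IntegrableOn f s :=
  (hf.continuousOn.integrableOn_compact hs.isCompact_closure).mono_set subset_closure

/-- The energy of `√a` is controlled by the Dirichlet energy of `a`. -/
theorem Eeps_sqrt_le {Ω : Set V2} (hΩ : IsOpen Ω) (hbd : Bornology.IsBounded Ω)
    {a : V2 → ℝ} (ha : ContDiff ℝ 1 a) {b : ℝ} (hb : 0 < b) (hab : ∀ x ∈ Ω, b ≤ a x) (ε : ℝ) :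
    Eeps Ω a ε (fun x => Real.sqrt (a x)) ≤ (1 / (8 * b)) * ∫ x in Ω, gradSq a x := by
  have key : ∫ x in Ω, (gradSq (fun y => Real.sqrt (a y)) x
        + (a x - Real.sqrt (a x) ^ 2) ^ 2 / (2 * ε ^ 2))
      ≤ ∫ x in Ω, (1 / (4 * b)) * gradSq a x := by
    refine integral_mono_of_nonneg (.of_forall fun x => ?_)
      ((integrableOn_of_continuous_of_isBounded hbd (continuous_gradSq ha)).const_mul _) ?_
    · exact add_nonneg (gradSq_nonneg _ x) (by positivity)
    · filter_upwards [ae_restrict_mem hΩ.measurableSet] with x hx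
      have hax : 0 < a x := hb.trans_le (hab x hx)
      have hg := gradSq_nonneg a x
      rw [gradSq_sqrt (ha.differentiable (by norm_num) x) hax, Real.sq_sqrt hax.le, sub_self,
        zero_pow two_ne_zero, zero_div, add_zero, div_eq_mul_one_div, mul_comm]
      gcongr
      exact hab x hx
  rw [integral_const_mul] at key
  unfold Eeps
  calc _ ≤ (1 / 2) * ((1 / (4 * b)) * ∫ x in Ω, gradSq a x) := by gcongr
    _ = _ := by ring

/-- Chebyshev bound for the set where `v ^ 2` differs from `a` by more than `t`. -/
theorem measure_mul_le_Eeps {Ω : Set V2} (hΩ : IsOpen Ω) (hbd : Bornology.IsBounded Ω)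
    {a v : V2 → ℝ} (ha : Continuous a) (hv : ContDiff ℝ 1 v) (ε : ℝ) {t : ℝ} (ht : 0 ≤ t) :
    t ^ 2 / (2 * ε ^ 2) * (volume {x ∈ Ω | t < |a x - v x ^ 2|}).toReal ≤ 2 * Eeps Ω a ε v := by
  have hvc := hv.continuous
  have hgc := continuous_gradSq hv
  have hint : IntegrableOn (fun x => gradSq v x + (a x - v x ^ 2) ^ 2 / (2 * ε ^ 2)) Ω := by
    refine integrableOn_of_continuous_of_isBounded hbd ?_
    fun_prop
  have hsub : {x ∈ Ω | t < |a x - v x ^ 2|} ⊆ Ω := Set.sep_subset _ _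
  have hmeas : MeasurableSet {x ∈ Ω | t < |a x - v x ^ 2|} :=
    hΩ.measurableSet.inter
      (isOpen_lt continuous_const (by fun_prop : Continuous fun x => |a x - v x ^ 2|)).measurableSet
  have hfin : volume {x ∈ Ω | t < |a x - v x ^ 2|} ≠ ⊤ :=
    ((measure_mono hsub).trans_lt hbd.measure_lt_top).ne
  have hnonneg : ∀ x, 0 ≤ gradSq v x + (a x - v x ^ 2) ^ 2 / (2 * ε ^ 2) :=
    fun x => add_nonneg (gradSq_nonneg _ x) (by positivity)
  calc _ ≤ ∫ x in {x ∈ Ω | t < |a x - v x ^ 2|},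
        (gradSq v x + (a x - v x ^ 2) ^ 2 / (2 * ε ^ 2)) := by
        refine setIntegral_ge_of_const_le_real hmeas hfin (fun x hx => ?_) (hint.mono_set hsub)
        have h : t ^ 2 ≤ (a x - v x ^ 2) ^ 2 := by
          rw [← sq_abs (a x - v x ^ 2)]
          exact pow_le_pow_left₀ ht hx.2.le 2
        have hg := gradSq_nonneg v x
        have := div_le_div_of_nonneg_right h (by positivity : 0 ≤ 2 * ε ^ 2)
        linarith
    _ ≤ ∫ x in Ω, (gradSq v x + (a x - v x ^ 2) ^ 2 / (2 * ε ^ 2)) :=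
        setIntegral_mono_set hint (.of_forall hnonneg) hsub.eventuallyLE
    _ = 2 * Eeps Ω a ε v := by
        unfold Eeps
        ring

/-- smallness of the set where ρ² differs from a by more than ε^α. -/
theorem statement4 (b : ℝ) (hb : b ∈ Set.Ioo (0 : ℝ) 1) :
    ∃ C > 0, ∀ (Ω : Set V2), IsOpen Ω → Bornology.IsBounded Ω → Nonempty (SmoothBdry Ω) →
      ∀ (ε : ℝ), ε ∈ Set.Ioo (0 : ℝ) 1 →
      ∀ (a : V2 → ℝ), ContDiff ℝ 1 a → (∀ x ∈ closure Ω, b ≤ a x ∧ a x ≤ 1) →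
      ∀ (ρ : V2 → ℝ), ContDiff ℝ 1 ρ →
        Eeps Ω a ε ρ ≤ Eeps Ω a ε (fun x => Real.sqrt (a x)) →
        ∀ α ∈ Set.Ioo (0 : ℝ) 1,
          (volume {x ∈ Ω | ε ^ α < |a x - ρ x ^ 2|}).toReal
            ≤ C * (∫ x in Ω, gradSq a x) * ε ^ (2 * (1 - α)) := by
  have hb0 : 0 < b := hb.1
  refine ⟨1 / (2 * b), by positivity, ?_⟩
  intro Ω hΩ hbd _ ε hε a ha hab ρ hρ hE α _
  have hε0 : 0 < ε := hε.1
  have hlow := measure_mul_le_Eeps hΩ hbd ha.continuous hρ ε (Real.rpow_nonneg hε0.le α)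
  have hup := Eeps_sqrt_le hΩ hbd ha hb0 (fun x hx => (hab x (subset_closure hx)).1) ε
  have hpow : ε ^ (2 * (1 - α)) = ε ^ 2 / (ε ^ α) ^ 2 := by
    rw [mul_sub, mul_one, Real.rpow_sub hε0, mul_comm 2 α, Real.rpow_mul hε0.le]
    norm_num
  have hα : 0 < ε ^ α := Real.rpow_pos_of_pos hε0 α
  rw [hpow]
  have h := hlow.trans (mul_le_mul_of_nonneg_left (hE.trans hup) zero_le_two)
  have hc : 0 ≤ 2 * ε ^ 2 / (ε ^ α) ^ 2 := by positivity
  calc _ = 2 * ε ^ 2 / (ε ^ α) ^ 2 * ((ε ^ α) ^ 2 / (2 * ε ^ 2)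
        * (volume {x ∈ Ω | ε ^ α < |a x - ρ x ^ 2|}).toReal) := by field_simp
    _ ≤ _ := mul_le_mul_of_nonneg_left h hc
    _ = _ := by
      field_simp
      norm_num
end
end

section
/- Let Ω ⊂ ℝ² be a bounded, open, simply connected domain with smooth boundary and b ∈ (0,1). There exists a constant c > 0, depending only on Ω and b, such that for every measurable ρ : Ω → ℝ with b ≤ ρ² ≤ 1 and every ξ ∈ C¹(clos(Ω); ℝ) with ξ = 0 on ∂Ω and 0 ≤ ξ ≤ 1 satisfying the weak formulation ∫_Ω ( ∇ξ·∇φ / ρ² + ξφ ) = ∫_Ω φ for every Lipschitz φ : clos(Ω) → ℝ vanishing on ∂Ω, one has max_{clos(Ω)} ξ ≥ c. -/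
noncomputable section

open MeasureTheory

/-- A `C¹` function agrees on a bounded set, to first order, with a globally Lipschitz multiple
of itself. -/
lemma exists_lipschitz_eq_on_bounded {s : Set V2} (hs : IsOpen s) (hb : Bornology.IsBounded s)
    {ξ : V2 → ℝ} (hξ : ContDiff ℝ 1 ξ) :
    ∃ φ : V2 → ℝ, (∃ K : NNReal, LipschitzWith K φ) ∧ (∀ x, ξ x = 0 → φ x = 0) ∧
      (∀ x ∈ s, φ x = ξ x) ∧ ∀ x ∈ s, fderiv ℝ φ x = fderiv ℝ ξ x := by
  obtain ⟨R, hR, hsub⟩ := hb.subset_closedBall_lt 0 (0 : V2)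
  let χ : ContDiffBump (0 : V2) := ⟨R, R + 1, hR, by linarith⟩
  have hφ : ∀ x ∈ s, χ x * ξ x = ξ x := fun x hx => by
    rw [χ.one_of_mem_closedBall (hsub hx), one_mul]
  refine ⟨fun x => χ x * ξ x, ?_, fun x hx => by simp [hx], hφ, fun x hx => ?_⟩
  · exact (χ.contDiff.mul hξ).lipschitzWith_of_hasCompactSupport
      χ.hasCompactSupport.mul_right one_ne_zero
  · exact Filter.EventuallyEq.fderiv_eq
      (Filter.eventually_of_mem (hs.mem_nhds hx) hφ)

/-- A nonempty open set carries a nonnegative `1`-Lipschitz function that vanishes on its boundary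
and has positive integral. -/
lemma exists_lipschitz_bump {s : Set V2} (hs : IsOpen s) (hb : Bornology.IsBounded s)
    (hne : s.Nonempty) :
    ∃ η : V2 → ℝ, LipschitzWith 1 η ∧ (∀ x, 0 ≤ η x) ∧ (∀ x ∈ frontier s, η x = 0) ∧
      0 < ∫ x in s, η x := by
  refine ⟨fun x => Metric.infDist x sᶜ, Metric.lipschitz_infDist_pt _,
    fun x => Metric.infDist_nonneg, fun x hx => ?_, ?_⟩
  · exact Metric.infDist_zero_of_mem (hs.frontier_eq ▸ hx).2
  · have hcne : (sᶜ : Set V2).Nonempty := by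
      rw [Set.nonempty_compl]
      rintro rfl
      exact NormedSpace.unbounded_univ ℝ V2 hb
    have hcont : Continuous fun x : V2 => Metric.infDist x sᶜ := Metric.continuous_infDist_pt _
    rw [setIntegral_pos_iff_support_of_nonneg_ae
      (Filter.Eventually.of_forall fun x => Metric.infDist_nonneg)
      ((hcont.continuousOn.integrableOn_compact hb.isCompact_closure).mono_set subset_closure)]
    refine (hs.measure_pos volume hne).trans_le (measure_mono fun x hx => ⟨?_, hx⟩)
    exact ((hs.isClosed_compl.notMem_iff_infDist_pos hcne).1 (by simpa using hx)).ne'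

/-- A weighted Young inequality. -/
lemma mul_add_mul_div_le {p q u v r b t : ℝ} (hb : 0 < b) (ht : 0 < t) (hr : b ≤ r)
    (hu : |u| ≤ 1) (hv : |v| ≤ 1) :
    (p * u + q * v) / r ≤ (2 * t)⁻¹ * ((p * p + q * q) / r) + t / b := by
  have hr0 : 0 < r := hb.trans_le hr
  have hu2 : u ^ 2 ≤ 1 := (sq_le_one_iff_abs_le_one u).2 hu
  have hv2 : v ^ 2 ≤ 1 := (sq_le_one_iff_abs_le_one v).2 hv
  have h1 : p * u + q * v ≤ (2 * t)⁻¹ * (p * p + q * q) + t := by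
    have : (2 * t)⁻¹ * (p * p + q * q) + t - (p * u + q * v)
        = (2 * t)⁻¹ * ((p - t * u) ^ 2 + (q - t * v) ^ 2 + t ^ 2 * (2 - u ^ 2 - v ^ 2)) := by
      field_simp
      ring
    have h2 : 0 ≤ 2 - u ^ 2 - v ^ 2 := by linarith
    have : 0 ≤ (2 * t)⁻¹ * (p * p + q * q) + t - (p * u + q * v) := by
      rw [this]; positivity
    linarith
  calc (p * u + q * v) / r ≤ ((2 * t)⁻¹ * (p * p + q * q) + t) / r := by gcongr
    _ = (2 * t)⁻¹ * ((p * p + q * q) / r) + t / r := by ring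
    _ ≤ _ := by gcongr

/-- the uniform lower bound max ξ ≥ c > 0. -/
theorem statement8
    (Ω : Set V2) (hΩo : IsOpen Ω) (hΩb : Bornology.IsBounded Ω)
    (hΩsc : SimplyConnectedSpace ↥Ω)
    (hsb : Nonempty (SmoothBdry Ω))
    (b : ℝ) (hb : b ∈ Set.Ioo (0 : ℝ) 1) :
    ∃ c > 0,
      ∀ (ρ : V2 → ℝ), Measurable ρ → (∀ x ∈ Ω, b ≤ ρ x ^ 2 ∧ ρ x ^ 2 ≤ 1) →
      ∀ (ξ : V2 → ℝ), ContDiff ℝ 1 ξ → (∀ x ∈ frontier Ω, ξ x = 0) →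
        (∀ x ∈ closure Ω, 0 ≤ ξ x ∧ ξ x ≤ 1) →
        (∀ φ : V2 → ℝ, (∃ K : NNReal, LipschitzWith K φ) →
          (∀ x ∈ frontier Ω, φ x = 0) →
          ∫ x in Ω, ((pd1 ξ x * pd1 φ x + pd2 ξ x * pd2 φ x) / ρ x ^ 2 + ξ x * φ x)
            = ∫ x in Ω, φ x) →
        ∃ x ∈ closure Ω, c ≤ ξ x := by
  obtain ⟨hb0, -⟩ := hb
  obtain ⟨x₀⟩ : Nonempty Ω := inferInstance
  obtain ⟨η, hηL, hη0, hηf, hI⟩ := exists_lipschitz_bump hΩo hΩb ⟨x₀, x₀.2⟩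
  set I := ∫ x in Ω, η x
  set V := volume.real Ω
  have hV : 0 ≤ V := measureReal_nonneg
  have hfin : volume Ω ≠ ⊤ := hΩb.measure_lt_top.ne
  set t := b * I / (4 * (V + 1)) with ht
  have ht0 : 0 < t := by positivity
  set c := min (1 / 4) (t * I / (2 * (V + 1)))
  have hc0 : 0 < c := by positivity
  refine ⟨c, hc0, fun ρ hρm hρ ξ hξ hξf hξ01 hweak => ?_⟩
  by_contra! hlt
  have hcpt : IsCompact (closure Ω) := hΩb.isCompact_closure
  have hcontInt : ∀ f : V2 → ℝ, Continuous f → IntegrableOn f Ω := fun f hf =>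
    (hf.continuousOn.integrableOn_compact hcpt).mono_set subset_closure
  have hρInt : ∀ f : V2 → ℝ, IntegrableOn f Ω → IntegrableOn (fun x => f x / ρ x ^ 2) Ω := by
    intro f hf
    simp only [div_eq_mul_inv]
    refine Integrable.mul_bdd (c := b⁻¹) hf (hρm.pow_const 2).inv.aestronglyMeasurable ?_
    filter_upwards [ae_restrict_mem hΩo.measurableSet] with x hx
    rw [Real.norm_of_nonneg (by positivity)]
    exact inv_anti₀ hb0 (hρ x hx).1
  have hpd : ∀ e : V2, Continuous fun x => fderiv ℝ ξ x e := fun e =>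
    (hξ.continuous_fderiv one_ne_zero).clm_apply continuous_const
  have hp1 : Continuous (pd1 ξ) := hpd ee1
  have hp2 : Continuous (pd2 ξ) := hpd ee2
  have hηd : ∀ e : V2, ‖e‖ = 1 → ∀ x, |fderiv ℝ η x e| ≤ 1 := fun e he x => by
    simpa [he] using (fderiv ℝ η x).le_of_opNorm_le (norm_fderiv_le_of_lipschitz ℝ hηL) e
  have hη1 : ∀ x, |pd1 η x| ≤ 1 := hηd ee1 (by simp [ee1])
  have hη2 : ∀ x, |pd2 η x| ≤ 1 := hηd ee2 (by simp [ee2])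
  have hmulInt : ∀ f : V2 → ℝ, Continuous f → ∀ e : V2, (∀ x, |fderiv ℝ η x e| ≤ 1) →
      IntegrableOn (fun x => f x * fderiv ℝ η x e) Ω := fun f hf e he =>
    Integrable.mul_bdd (c := 1) (hcontInt f hf)
      (measurable_fderiv_apply_const ℝ η e).aestronglyMeasurable (Filter.Eventually.of_forall he)
  have hEint : IntegrableOn
      (fun x => (pd1 ξ x * pd1 ξ x + pd2 ξ x * pd2 ξ x) / ρ x ^ 2 + ξ x * ξ x) Ω :=
    (hρInt _ (hcontInt _ ((hp1.mul hp1).add (hp2.mul hp2)))).add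
      (hcontInt _ (hξ.continuous.mul hξ.continuous))
  have henergy : ∫ x in Ω, ((pd1 ξ x * pd1 ξ x + pd2 ξ x * pd2 ξ x) / ρ x ^ 2 + ξ x * ξ x)
      ≤ c * V := by
    obtain ⟨φ, hφL, hφ0, hφ, hφd⟩ := exists_lipschitz_eq_on_bounded hΩo hΩb hξ
    have h := hweak φ hφL fun x hx => hφ0 x (hξf x hx)
    rw [setIntegral_congr_fun hΩo.measurableSet hφ,
      setIntegral_congr_fun hΩo.measurableSet (g := fun x =>
        (pd1 ξ x * pd1 ξ x + pd2 ξ x * pd2 ξ x) / ρ x ^ 2 + ξ x * ξ x)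
        fun x hx => by simp only [pd1, pd2, hφ x hx, hφd x hx]] at h
    rw [h]
    calc ∫ x in Ω, ξ x ≤ ∫ _ in Ω, c :=
          setIntegral_mono_on (hcontInt _ hξ.continuous) (integrableOn_const hfin)
            hΩo.measurableSet fun x hx => (hlt x (subset_closure hx)).le
      _ = c * V := by rw [setIntegral_const, smul_eq_mul, mul_comm]
  have htest : I ≤ (2 * t)⁻¹ * (c * V) + t / b * V + c * I := by
    have hηint := hcontInt η hηL.continuous
    calc I = ∫ x in Ω, ((pd1 ξ x * pd1 η x + pd2 ξ x * pd2 η x) / ρ x ^ 2 + ξ x * η x) :=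
          (hweak η ⟨1, hηL⟩ hηf).symm
      _ ≤ ∫ x in Ω, ((2 * t)⁻¹ * ((pd1 ξ x * pd1 ξ x + pd2 ξ x * pd2 ξ x) / ρ x ^ 2 + ξ x * ξ x)
            + t / b + c * η x) := by
        refine setIntegral_mono_on ?_ ?_ hΩo.measurableSet fun x hx => ?_
        · exact (hρInt _ ((hmulInt _ hp1 ee1 hη1).add (hmulInt _ hp2 ee2 hη2))).add
            (hcontInt _ (hξ.continuous.mul hηL.continuous))
        · exact ((hEint.const_mul _).add (integrableOn_const hfin)).add (hηint.const_mul _)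
        · have h1 := mul_add_mul_div_le (p := pd1 ξ x) (q := pd2 ξ x) hb0 ht0 (hρ x hx).1
            (hη1 x) (hη2 x)
          have h2 := mul_le_mul_of_nonneg_right (hlt x (subset_closure hx)).le (hη0 x)
          have h3 : 0 ≤ (2 * t)⁻¹ * (ξ x * ξ x) :=
            mul_nonneg (by positivity) (mul_self_nonneg _)
          linarith
      _ = (2 * t)⁻¹ * (∫ x in Ω,
            ((pd1 ξ x * pd1 ξ x + pd2 ξ x * pd2 ξ x) / ρ x ^ 2 + ξ x * ξ x))
            + t / b * V + c * I := by
        have hconst : IntegrableOn (fun _ : V2 => t / b) Ω := integrableOn_const hfin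
        have hsum : IntegrableOn (fun x => (2 * t)⁻¹ *
            ((pd1 ξ x * pd1 ξ x + pd2 ξ x * pd2 ξ x) / ρ x ^ 2 + ξ x * ξ x) + t / b) Ω :=
          (hEint.const_mul _).add hconst
        rw [integral_add hsum (hηint.const_mul _), integral_add (hEint.const_mul _) hconst,
          integral_const_mul, integral_const_mul, setIntegral_const, smul_eq_mul,
          mul_comm (volume.real Ω)]
      _ ≤ _ := by gcongr
  have hV1 : V / (V + 1) ≤ 1 := (div_le_one (by positivity)).2 (by linarith)
  have h1 : (2 * t)⁻¹ * (c * V) ≤ I / 4 := by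
    calc (2 * t)⁻¹ * (c * V) ≤ (2 * t)⁻¹ * (t * I / (2 * (V + 1)) * V) := by
          gcongr; exact min_le_right _ _
      _ = I / 4 * (V / (V + 1)) := by field_simp; ring
      _ ≤ I / 4 := mul_le_of_le_one_right (by positivity) hV1
  have h2 : t / b * V ≤ I / 4 := by
    calc t / b * V = I / 4 * (V / (V + 1)) := by rw [ht]; field_simp
      _ ≤ I / 4 := mul_le_of_le_one_right (by positivity) hV1
  have h3 : c * I ≤ 1 / 4 * I := by gcongr; exact min_le_left _ _
  linarith
end
end
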